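/- arXiv:1405.1278 — 2 statements merged into one kernel-verified Lean document; each statement's English description precedes it below -/
import Mathlib

section
/- Let Λ be an Artin algebra with radical r, (e, f) complementary idempotents with fΛe ⊆ r, and Λ* = fΛf with r* = frf. Assume pd_{Λ*}(fΛe) < ∞, pd_Λ((Λ/r)e) < ∞, and id_Λ((Λ/r)e) < ∞. Then Λ has finite global dimension if and only if Λ* has finite global dimension. -/
/-! STATEMENT 16: Let `Λ` be an Artin algebra with radical `r`, `(e, f)` a suitable
idempotent pair, `Λ* = fΛf`.  Assume `pd_{Λ*}(fΛe) < ∞`, `pd_Λ((Λ/r)e) < ∞` and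
`id_Λ((Λ/r)e) < ∞`.  Then `Λ` has finite global dimension iff `Λ*` has finite global
dimension (finite global dimension being encoded as uniform vanishing of high Ext). -/

universe u

section CornerLib

variable {Λ : Type u} [Ring Λ]

/-- The set `{x | f * x * f = x}`, i.e. the corner `fΛf`, as an additive subgroup. -/
def cornerAddSubgroup (f : Λ) : AddSubgroup Λ where
  carrier := {x | f * x * f = x}
  add_mem' := by
    intro a b ha hb
    simp only [Set.mem_setOf_eq] at *
    rw [mul_add, add_mul, ha, hb]
  zero_mem' := by simp
  neg_mem' := by
    intro a ha
    simp only [Set.mem_setOf_eq] at *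
    rw [mul_neg, neg_mul, ha]

/-- The corner ring `fΛf`. -/
def Corner (f : Λ) : Type u := ↥(cornerAddSubgroup f)

instance (e : Λ) [he : Fact (IsIdempotentElem e)] : Fact (IsIdempotentElem (1 - e)) :=
  ⟨he.out.one_sub⟩

namespace Corner

variable {f : Λ} [hf : Fact (IsIdempotentElem f)]

instance : AddCommGroup (Corner f) :=
  inferInstanceAs (AddCommGroup ↥(cornerAddSubgroup f))

theorem absorb_left {x : Λ} (hx : f * x * f = x) : f * x = x := by
  conv_lhs => rw [← hx]
  rw [← mul_assoc, ← mul_assoc, hf.out]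
  exact hx

theorem absorb_right {x : Λ} (hx : f * x * f = x) : x * f = x := by
  conv_lhs => rw [← hx]
  rw [mul_assoc, mul_assoc, hf.out]
  rw [← mul_assoc]
  exact hx

theorem mul_mem' {x y : Λ} (hx : f * x * f = x) (hy : f * y * f = y) :
    f * (x * y) * f = x * y := by
  rw [← mul_assoc f x y, absorb_left hx, mul_assoc, absorb_right hy]

instance : Ring (Corner f) :=
  { (inferInstance : AddCommGroup (Corner f)) with
    mul := fun x y => ⟨x.1 * y.1, mul_mem' x.2 y.2⟩
    one := ⟨f, by show f * f * f = f; rw [hf.out, hf.out]⟩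
    mul_assoc := fun a b c => Subtype.ext (mul_assoc a.1 b.1 c.1)
    one_mul := fun a => Subtype.ext (absorb_left a.2)
    mul_one := fun a => Subtype.ext (absorb_right a.2)
    left_distrib := fun a b c => Subtype.ext (mul_add a.1 b.1 c.1)
    right_distrib := fun a b c => Subtype.ext (add_mul a.1 b.1 c.1)
    zero_mul := fun a => Subtype.ext (zero_mul a.1)
    mul_zero := fun a => Subtype.ext (mul_zero a.1) }

@[simp] theorem mul_val (x y : Corner f) : (x * y).1 = x.1 * y.1 := rfl
@[simp] theorem one_val : (1 : Corner f).1 = f := rfl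

end Corner

/-- For a left `Λ`-module `M`, the subgroup `fM = {m | f • m = m}`. -/
def cornerSubAddSubgroup (f : Λ) (M : Type u) [AddCommGroup M] [Module Λ M] :
    AddSubgroup M where
  carrier := {m | f • m = m}
  add_mem' := by
    intro a b ha hb
    simp only [Set.mem_setOf_eq] at *
    rw [smul_add, ha, hb]
  zero_mem' := by simp
  neg_mem' := by
    intro a ha
    simp only [Set.mem_setOf_eq] at *
    rw [smul_neg, ha]

/-- `fM`, the image of a left `Λ`-module `M` under the idempotent `f`;
this is the concrete incarnation of `fΛ ⊗_Λ M`. -/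
def CornerSub (f : Λ) (M : Type u) [AddCommGroup M] [Module Λ M] : Type u :=
  ↥(cornerSubAddSubgroup f M)

namespace CornerSub

variable {f : Λ} [hf : Fact (IsIdempotentElem f)]
variable {M : Type u} [AddCommGroup M] [Module Λ M]

instance : AddCommGroup (CornerSub f M) :=
  inferInstanceAs (AddCommGroup ↥(cornerSubAddSubgroup f M))

instance : SMul (Corner f) (CornerSub f M) :=
  ⟨fun a m => ⟨a.1 • m.1, by
    show f • a.1 • m.1 = a.1 • m.1
    rw [smul_smul, Corner.absorb_left a.2]⟩⟩

@[simp] theorem smul_val (a : Corner f) (m : CornerSub f M) :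
    (a • m).1 = a.1 • m.1 := rfl

instance : Module (Corner f) (CornerSub f M) where
  one_smul m := Subtype.ext m.2
  mul_smul a b m := Subtype.ext (mul_smul a.1 b.1 m.1)
  smul_add a m n := Subtype.ext (smul_add a.1 m.1 n.1)
  add_smul a b m := Subtype.ext (add_smul a.1 b.1 m.1)
  zero_smul m := Subtype.ext (zero_smul Λ m.1)
  smul_zero a := Subtype.ext (smul_zero a.1)

end CornerSub

/-- The functorial action of `M ↦ fM` on a `Λ`-linear map. -/
def cornerMap (f : Λ) [hf : Fact (IsIdempotentElem f)]
    {M N : Type u} [AddCommGroup M] [Module Λ M] [AddCommGroup N] [Module Λ N]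
    (g : M →ₗ[Λ] N) : CornerSub f M →ₗ[Corner f] CornerSub f N where
  toFun m := ⟨g m.1, by show f • g m.1 = g m.1; rw [← map_smul, m.2]⟩
  map_add' m n := Subtype.ext (map_add g m.1 n.1)
  map_smul' a m := Subtype.ext (map_smul g a.1 m.1)

/-- The left ideal `Λe`. -/
def lambdaE (e : Λ) : Submodule Λ Λ :=
  LinearMap.range (LinearMap.toSpanSingleton Λ Λ e)

/-- The Jacobson radical of a ring. -/
def jacRad (Λ : Type u) [Ring Λ] : Ideal Λ := Ideal.jacobson (⊥ : Ideal Λ)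

end CornerLib

open CategoryTheory

/-- `(Λ/r)ε`, the image of `Λε` in `Λ/r`, as an object of `ModuleCat Λ`. -/
def radQuotPart (Λ : Type u) [Ring Λ] (ε : Λ) : ModuleCat.{u} Λ :=
  ModuleCat.of Λ ↥(Submodule.map (jacRad Λ).mkQ (lambdaE ε))

/-- The radical `r* = f r f` of `Λ* = fΛf`, as a left ideal of the corner ring. -/
def rStar {Λ : Type u} [Ring Λ] (f : Λ) [Fact (IsIdempotentElem f)] :
    Ideal (Corner f) where
  carrier := {x | x.1 ∈ jacRad Λ}
  add_mem' := fun ha hb => (jacRad Λ).add_mem ha hb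
  zero_mem' := (jacRad Λ).zero_mem
  smul_mem' := fun c x hx => (jacRad Λ).smul_mem c.1 hx

/-- `Λ*/r*` as an object of `ModuleCat Λ*`. -/
def starSemisimpleQuot {Λ : Type u} [Ring Λ] (f : Λ) [Fact (IsIdempotentElem f)] :
    ModuleCat.{u} (Corner f) :=
  ModuleCat.of (Corner f) (Corner f ⧸ rStar f)

section PDLib

variable {R : Type u} [Ring R]

/-- Unbundled: projective dimension `< n`. -/
def PD (R : Type u) [Ring R] (M : Type u) [AddCommGroup M] [Module R M] (n : ℕ) : Prop :=
  HasProjectiveDimensionLT (ModuleCat.of R M) n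

variable {M N L : Type u} [AddCommGroup M] [Module R M] [AddCommGroup N] [Module R N]
  [AddCommGroup L] [Module R L]

theorem PD.mono {m n : ℕ} (h : PD R M m) (hmn : m ≤ n) : PD R M n := by
  unfold PD at *
  exact hasProjectiveDimensionLT_of_ge _ m n hmn

theorem PD.retract {n : ℕ} (h : PD R N n) (i : M →ₗ[R] N) (p : N →ₗ[R] M)
    (hpi : ∀ x, p (i x) = x) : PD R M n := by
  unfold PD at *
  let r : Retract (ModuleCat.of R M) (ModuleCat.of R N) :=
    { i := ModuleCat.ofHom i
      r := ModuleCat.ofHom p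
      retract := by ext x; exact hpi x }
  exact r.hasProjectiveDimensionLT n

theorem PD.equiv {n : ℕ} (h : PD R N n) (i : M ≃ₗ[R] N) : PD R M n :=
  h.retract i.toLinearMap i.symm.toLinearMap (by simp)

theorem PD.zero_iff : PD R M 0 ↔ Subsingleton M := by
  unfold PD
  rw [hasProjectiveDimensionLT_zero_iff_isZero]
  constructor
  · intro h; exact ModuleCat.subsingleton_of_isZero h
  · intro h; exact ModuleCat.isZero_of_subsingleton _

theorem PD.one_iff : PD R M 1 ↔ Module.Projective R M := by
  unfold PD
  rw [← projective_iff_hasProjectiveDimensionLT_one, ← IsProjective.iff_projective]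

theorem PD.seq (f : M →ₗ[R] N) (g : N →ₗ[R] L) (hf : Function.Injective f)
    (hg : Function.Surjective g) (hfg : Function.Exact f g) :
    (ModuleCat.shortComplexOfCompEqZero f g hfg.linearMap_comp_eq_zero).ShortExact :=
  ModuleCat.shortComplex_shortExact _ hfg hf hg

theorem PD.mid {n : ℕ} (f : M →ₗ[R] N) (g : N →ₗ[R] L) (hf : Function.Injective f)
    (hg : Function.Surjective g) (hfg : Function.Exact f g) (h1 : PD R M n) (h3 : PD R L n) :
    PD R N n :=
  (PD.seq f g hf hg hfg).hasProjectiveDimensionLT_X₂ n h1 h3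

theorem PD.right {n : ℕ} (f : M →ₗ[R] N) (g : N →ₗ[R] L) (hf : Function.Injective f)
    (hg : Function.Surjective g) (hfg : Function.Exact f g) (h1 : PD R M n)
    (h2 : PD R N (n + 1)) : PD R L (n + 1) :=
  (PD.seq f g hf hg hfg).hasProjectiveDimensionLT_X₃ n h1 h2

theorem PD.left {n : ℕ} (f : M →ₗ[R] N) (g : N →ₗ[R] L) (hf : Function.Injective f)
    (hg : Function.Surjective g) (hfg : Function.Exact f g) (h2 : PD R N n)
    (h3 : PD R L (n + 1)) : PD R M n :=
  (PD.seq f g hf hg hfg).hasProjectiveDimensionLT_X₁ n h2 h3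

theorem PD.iff_ext [HasExt.{u} (ModuleCat.{u} R)] {n : ℕ} :
    PD R M (n + 1) ↔ ∀ (N : ModuleCat.{u} R) (k : ℕ), n < k →
      Subsingleton (Abelian.Ext (ModuleCat.of R M) N k) := by
  unfold PD
  constructor
  · intro h N k hk
    exact HasProjectiveDimensionLT.subsingleton _ (n + 1) k hk N
  · intro h
    refine HasProjectiveDimensionLT.mk fun i hi Y x => ?_
    have := h Y i hi
    exact Subsingleton.elim _ _

/-- The free cover. -/
noncomputable abbrev frc (R : Type u) [Ring R] (M : Type u) [AddCommGroup M] [Module R M] : (M →₀ R) →ₗ[R] M :=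
  Finsupp.linearCombination R (id : M → M)

theorem frc_surj : Function.Surjective (frc R M) := fun m =>
  ⟨Finsupp.single m 1, by simp [frc]⟩

theorem PD.ker_surj {n : ℕ} (g : N →ₗ[R] L) (hg : Function.Surjective g)
    (h2 : Module.Projective R N) (h3 : PD R L (n + 2)) : PD R (LinearMap.ker g) (n + 1) :=
  PD.left (LinearMap.ker g).subtype g (LinearMap.ker g).injective_subtype hg
    (LinearMap.exact_subtype_ker_map g) ((PD.one_iff.2 h2).mono (by omega)) h3

theorem PD.of_ker_surj {n : ℕ} (g : N →ₗ[R] L) (hg : Function.Surjective g)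
    (h2 : PD R N (n + 1)) (h3 : PD R (LinearMap.ker g) n) : PD R L (n + 1) :=
  PD.right (LinearMap.ker g).subtype g (LinearMap.ker g).injective_subtype hg
    (LinearMap.exact_subtype_ker_map g) h3 h2

theorem PD.of_quot {n : ℕ} (K : Submodule R M) (h1 : PD R K n) (h3 : PD R (M ⧸ K) n) :
    PD R M n :=
  PD.mid K.subtype K.mkQ K.injective_subtype K.mkQ_surjective (LinearMap.exact_subtype_mkQ K) h1 h3

theorem PD.finsupp (I : Type u) (n : ℕ) : ∀ (M : Type u) [AddCommGroup M] [Module R M],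
    PD R M n → PD R (I →₀ M) n := by
  induction n using Nat.strong_induction_on with
  | _ n ih =>
    intro M _ _ h
    match n, ih, h with
    | 0, _, h =>
      rw [PD.zero_iff] at *
      infer_instance
    | 1, _, h =>
      rw [PD.one_iff] at *
      classical
      have : ∀ m : M, Decidable (m ≠ 0) := fun _ => Classical.dec _
      exact Module.Projective.of_equiv (finsuppLequivDFinsupp (ι := I) (M := M) R).symm
    | n + 2, ih, h =>
      have hk := PD.ker_surj (frc R M) frc_surj inferInstance h
      have hk2 := ih (n + 1) (by omega) _ hk
      refine PD.right (N := I →₀ (M →₀ R)) (Finsupp.mapRange.linearMap (LinearMap.ker (frc R M)).subtype)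
        (Finsupp.mapRange.linearMap (α := I) (frc R M)) ?_ ?_ ?_ hk2 ?_
      · exact Finsupp.mapRange_injective _ (by simp) (Submodule.injective_subtype _)
      · exact Finsupp.mapRange_surjective _ (by simp) frc_surj
      · intro x
        constructor
        · intro hx
          classical
          refine ⟨x.mapRange (fun y => if hy : y ∈ LinearMap.ker (frc R M) then ⟨y, hy⟩ else 0)
            (by simp), ?_⟩
          ext1 i
          have : frc R M (x i) = 0 := by simpa using DFunLike.congr_fun hx i
          simp [Finsupp.mapRange_apply, this]
        · rintro ⟨y, rfl⟩
          ext1 i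
          have := (y i).2
          simpa using this
      · have : PD R (I →₀ (M →₀ R)) 1 := ih 1 (by omega) _ (PD.one_iff.2 inferInstance)
        exact this.mono (by omega)

end PDLib

section CornerPD

variable {Λ : Type u} [Ring Λ] {f : Λ} [hf : Fact (IsIdempotentElem f)]
variable {M N L : Type u} [AddCommGroup M] [Module Λ M] [AddCommGroup N] [Module Λ N]
  [AddCommGroup L] [Module Λ L]

@[simp] theorem cornerMap_val (g : M →ₗ[Λ] N) (m : CornerSub f M) :
    (cornerMap f g m).1 = g m.1 := rfl

@[simp] theorem CornerSub.zero_val : (0 : CornerSub f M).1 = 0 := rfl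
@[simp] theorem CornerSub.add_val (a b : CornerSub f M) : (a + b).1 = a.1 + b.1 := rfl
@[simp] theorem Corner.zero_val : (0 : Corner f).1 = 0 := rfl
@[simp] theorem Corner.add_val (a b : Corner f) : (a + b).1 = a.1 + b.1 := rfl

/-- the element `f m` of `fM`. -/
def CornerSub.mk' (f : Λ) [hf : Fact (IsIdempotentElem f)] (m : M) : CornerSub f M :=
  ⟨f • m, by show f • f • m = f • m; rw [smul_smul, hf.out]⟩

theorem CornerSub.prop (m : CornerSub f M) : f • m.1 = m.1 := m.2

theorem cornerMap_inj (g : M →ₗ[Λ] N) (hg : Function.Injective g) :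
    Function.Injective (cornerMap f g) := fun a b h =>
  Subtype.ext (hg (congrArg Subtype.val h))

theorem cornerMap_surj (g : M →ₗ[Λ] N) (hg : Function.Surjective g) :
    Function.Surjective (cornerMap f g) := fun b => by
  obtain ⟨m, hm⟩ := hg b.1
  refine ⟨CornerSub.mk' f m, Subtype.ext ?_⟩
  show g (f • m) = b.1
  rw [map_smul, hm, b.prop]

theorem cornerMap_exact (g : M →ₗ[Λ] N) (h : N →ₗ[Λ] L) (hgh : Function.Exact g h) :
    Function.Exact (cornerMap f g) (cornerMap f h) := by
  intro y
  constructor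
  · intro hy
    obtain ⟨m, hm⟩ := (hgh y.1).1 (congrArg Subtype.val hy)
    refine ⟨CornerSub.mk' f m, Subtype.ext ?_⟩
    show g (f • m) = y.1
    rw [map_smul, hm, y.prop]
  · rintro ⟨x, rfl⟩
    exact Subtype.ext ((hgh _).2 ⟨x.1, rfl⟩)

/-- `fΛ → fΛf`. -/
def toCorner (f : Λ) [hf : Fact (IsIdempotentElem f)] :
    CornerSub f Λ →ₗ[Corner f] Corner f where
  toFun y := ⟨y.1 * f, by
    have h : f * y.1 = y.1 := y.2
    show f * (y.1 * f) * f = y.1 * f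
    rw [← mul_assoc, h, mul_assoc, hf.out]⟩
  map_add' a b := Subtype.ext (add_mul a.1 b.1 f)
  map_smul' a b := Subtype.ext (mul_assoc a.1 b.1 f)

@[simp] theorem toCorner_val (y : CornerSub f Λ) : (toCorner f y).1 = y.1 * f := rfl

/-- `(fΛ)^(I) → f(Λ^(I))` is split by this. -/
noncomputable def cornerFinsuppTo (f : Λ) [hf : Fact (IsIdempotentElem f)] (I : Type u) :
    CornerSub f (I →₀ Λ) →ₗ[Corner f] (I →₀ CornerSub f Λ) where
  toFun y := y.1.mapRange (fun z => CornerSub.mk' f z) (Subtype.ext (smul_zero f))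
  map_add' a b := by
    ext1 i
    exact Subtype.ext (smul_add f (a.1 i) (b.1 i))
  map_smul' a b := by
    ext1 i
    apply Subtype.ext
    show f * (a.1 * b.1 i) = a.1 * (f * b.1 i)
    have h : f * b.1 i = b.1 i := DFunLike.congr_fun b.prop i
    rw [h, ← mul_assoc, Corner.absorb_left a.2]

noncomputable def cornerFinsuppFrom (f : Λ) [hf : Fact (IsIdempotentElem f)] (I : Type u) :
    (I →₀ CornerSub f Λ) →ₗ[Corner f] CornerSub f (I →₀ Λ) where
  toFun y := ⟨y.mapRange Subtype.val rfl, by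
    show f • y.mapRange Subtype.val rfl = _
    ext i
    exact (y i).prop⟩
  map_add' a b := Subtype.ext (by ext1 i; rfl)
  map_smul' a b := Subtype.ext (by ext1 i; rfl)

theorem cornerFinsupp_split (I : Type u) (x : CornerSub f (I →₀ Λ)) :
    cornerFinsuppFrom f I (cornerFinsuppTo f I x) = x := by
  apply Subtype.ext
  ext i
  exact DFunLike.congr_fun x.prop i

theorem corner_base {c : ℕ} (hc : PD (Corner f) (CornerSub f Λ) c) (hM : Module.Projective Λ M) :
    PD (Corner f) (CornerSub f M) c := by
  obtain ⟨s, hs⟩ := Module.projective_def'.1 hM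
  have h1 : PD (Corner f) (CornerSub f (M →₀ Λ)) c :=
    (PD.finsupp M c _ hc).retract (cornerFinsuppTo f M) (cornerFinsuppFrom f M)
      (cornerFinsupp_split M)
  refine h1.retract (cornerMap f s) (cornerMap f (frc Λ M)) fun x => Subtype.ext ?_
  exact LinearMap.congr_fun hs x.1

theorem corner_step {c : ℕ} (hc : PD (Corner f) (CornerSub f Λ) (c + 1)) (n : ℕ) :
    ∀ (M : Type u) [AddCommGroup M] [Module Λ M], PD Λ M (n + 1) →
      PD (Corner f) (CornerSub f M) (n + c + 1) := by
  induction n with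
  | zero =>
    intro M _ _ h
    exact (corner_base hc (PD.one_iff.1 h)).mono (by omega)
  | succ n ih =>
    intro M _ _ h
    have hk := ih _ (PD.ker_surj (frc Λ M) frc_surj inferInstance h)
    have := PD.right (cornerMap f (LinearMap.ker (frc Λ M)).subtype) (cornerMap f (frc Λ M))
      (cornerMap_inj _ (Submodule.injective_subtype _)) (cornerMap_surj _ frc_surj)
      (cornerMap_exact _ _ (LinearMap.exact_subtype_ker_map _)) hk
      ((corner_base hc inferInstance).mono (by omega))
    exact this.mono (by omega)

/-- Coinduced module `Hom_{Λ*}(fΛ, X)`. -/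
def CoInd (f : Λ) [hf : Fact (IsIdempotentElem f)] (X : Type u) [AddCommGroup X]
    [Module (Corner f) X] : Type u := CornerSub f Λ →ₗ[Corner f] X

/-- Right multiplication on `fΛ`. -/
def rmul (f : Λ) [hf : Fact (IsIdempotentElem f)] (a : Λ) :
    CornerSub f Λ →ₗ[Corner f] CornerSub f Λ := cornerMap f (LinearMap.toSpanSingleton Λ Λ a)

variable {X : Type u} [AddCommGroup X] [Module (Corner f) X]

instance : AddCommGroup (CoInd f X) :=
  inferInstanceAs (AddCommGroup (CornerSub f Λ →ₗ[Corner f] X))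

instance : SMul Λ (CoInd f X) := ⟨fun a φ => LinearMap.comp φ (rmul f a)⟩

theorem rmul_val (a : Λ) (y : CornerSub f Λ) : (rmul f a y).1 = y.1 * a := rfl

instance : FunLike (CoInd f X) (CornerSub f Λ) X :=
  inferInstanceAs (FunLike (CornerSub f Λ →ₗ[Corner f] X) _ _)

theorem CoInd.smul_apply (a : Λ) (φ : CoInd f X) (y) : (a • φ) y = φ (rmul f a y) := rfl
theorem CoInd.add_apply (φ ψ : CoInd f X) (y) : (φ + ψ) y = φ y + ψ y := rfl
theorem CoInd.map_add (φ : CoInd f X) (y z) : φ (y + z) = φ y + φ z := LinearMap.map_add φ y z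
theorem CoInd.map_zero (φ : CoInd f X) : φ 0 = 0 := LinearMap.map_zero φ
theorem CoInd.map_smul (φ : CoInd f X) (a : Corner f) (y : CornerSub f Λ) : φ (a • y) = a • φ y := LinearMap.map_smul φ a y

instance : Module Λ (CoInd f X) where
  one_smul φ := by
    refine DFunLike.ext _ _ fun y => ?_
    rw [CoInd.smul_apply]
    congr 1
    exact Subtype.ext (mul_one y.1)
  mul_smul a b φ := by
    refine DFunLike.ext _ _ fun y => ?_
    rw [CoInd.smul_apply, CoInd.smul_apply, CoInd.smul_apply]
    congr 1
    exact Subtype.ext (mul_assoc y.1 a b).symm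
  smul_add a m n := rfl
  smul_zero a := rfl
  add_smul a b φ := by
    refine DFunLike.ext _ _ fun y => ?_
    rw [CoInd.add_apply, CoInd.smul_apply, CoInd.smul_apply, CoInd.smul_apply, ← CoInd.map_add]
    congr 1
    exact Subtype.ext (mul_add y.1 a b)
  zero_smul φ := by
    refine DFunLike.ext _ _ fun y => ?_
    rw [CoInd.smul_apply]
    have : rmul f 0 y = 0 := Subtype.ext (mul_zero y.1)
    rw [this, CoInd.map_zero]
    rfl

def CoInd.of (f : Λ) [hf : Fact (IsIdempotentElem f)] (X : Type u) [AddCommGroup X]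
    [Module (Corner f) X] : X →ₗ[Corner f] CornerSub f (CoInd f X) where
  toFun x := ⟨(LinearMap.toSpanSingleton (Corner f) X x).comp (toCorner f), by
    refine DFunLike.ext _ _ fun y => ?_
    show toCorner f (rmul f f y) • x = toCorner f y • x
    congr 1
    apply Subtype.ext
    show y.1 * f * f = y.1 * f
    rw [mul_assoc, hf.out]⟩
  map_add' a b := Subtype.ext (DFunLike.ext _ _ fun y => smul_add _ _ _)
  map_smul' a b := Subtype.ext (DFunLike.ext _ _ fun y => by
    show toCorner f y • a • b = toCorner f (rmul f a.1 y) • b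
    rw [smul_smul]
    congr 1
    apply Subtype.ext
    show y.1 * f * a.1 = y.1 * a.1 * f
    rw [mul_assoc, mul_assoc, Corner.absorb_left a.2, Corner.absorb_right a.2])

/-- The element `f` of `fΛ`. -/
def cornerOne (f : Λ) [hf : Fact (IsIdempotentElem f)] : CornerSub f Λ := ⟨f, hf.out⟩

def CoInd.to (f : Λ) [hf : Fact (IsIdempotentElem f)] (X : Type u) [AddCommGroup X]
    [Module (Corner f) X] : CornerSub f (CoInd f X) →ₗ[Corner f] X where
  toFun φ := φ.1 (cornerOne f)
  map_add' a b := rfl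
  map_smul' a φ := by
    show φ.1 (rmul f a.1 (cornerOne f)) = a • φ.1 (cornerOne f)
    rw [← CoInd.map_smul]
    congr 1
    apply Subtype.ext
    show f * a.1 = a.1 * f
    rw [Corner.absorb_left a.2, Corner.absorb_right a.2]

theorem forward {c n : ℕ} (hc : PD (Corner f) (CornerSub f Λ) (c + 1))
    (h : ∀ (M : Type u) [AddCommGroup M] [Module Λ M], PD Λ M (n + 1))
    (X : Type u) [AddCommGroup X] [Module (Corner f) X] : PD (Corner f) X (n + c + 1) := by
  refine (corner_step hc n (CoInd f X) (h _)).retract (CoInd.of f X) (CoInd.to f X) fun x => ?_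
  show toCorner f (cornerOne f) • x = x
  have : toCorner f (cornerOne f) = 1 := Subtype.ext hf.out
  rw [this, one_smul]

end CornerPD

theorem pd_fLambda {Λ : Type u} [Ring Λ] (e : Λ) [he : Fact (IsIdempotentElem e)] {c : ℕ}
    (h : PD (Corner (1 - e)) (CornerSub (1 - e) ↥(lambdaE e)) (c + 1)) :
    PD (Corner (1 - e)) (CornerSub (1 - e) Λ) (c + 1) := by
  refine PD.mid (cornerMap (1 - e) (lambdaE e).subtype) (toCorner (1 - e))
    (cornerMap_inj _ (Submodule.injective_subtype _)) ?_ ?_ h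
    ((PD.one_iff.2 inferInstance).mono (by omega))
  · intro a
    exact ⟨⟨a.1, Corner.absorb_left a.2⟩, Subtype.ext (Corner.absorb_right a.2)⟩
  · intro y
    constructor
    · intro hy
      have h1 : y.1 * (1 - e) = 0 := congrArg Subtype.val hy
      have h2 : y.1 * e = y.1 := by
        rw [mul_sub, mul_one, sub_eq_zero] at h1
        exact h1.symm
      exact ⟨⟨⟨y.1, ⟨y.1, h2⟩⟩, Subtype.ext y.2⟩, rfl⟩
    · rintro ⟨x, rfl⟩
      obtain ⟨z, hz⟩ := x.1.2
      apply Subtype.ext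
      show x.1.1 * (1 - e) = 0
      rw [← hz]
      show z * e * (1 - e) = 0
      rw [mul_assoc, mul_sub, mul_one, he.out, sub_self, mul_zero]

section LiftProj

variable {Λ : Type u} [Ring Λ] {f : Λ} [hf : Fact (IsIdempotentElem f)]
variable {M : Type u} [AddCommGroup M] [Module Λ M]

def cornerIncl (f : Λ) [hf : Fact (IsIdempotentElem f)] :
    Corner f →ₗ[Corner f] CornerSub f Λ where
  toFun a := ⟨a.1, Corner.absorb_left a.2⟩
  map_add' a b := rfl
  map_smul' a b := rfl

noncomputable def jmap (f : Λ) [hf : Fact (IsIdempotentElem f)] (Q : Type u) :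
    (Q →₀ Corner f) →ₗ[Corner f] CornerSub f (Q →₀ Λ) :=
  (cornerFinsuppFrom f Q).comp (Finsupp.mapRange.linearMap (cornerIncl f))

theorem jmap_apply (Q : Type u) (x : Q →₀ Corner f) (q : Q) : (jmap f Q x).1 q = (x q).1 := rfl

theorem jmap_single (Q : Type u) (q : Q) (a : Corner f) :
    (jmap f Q (Finsupp.single q a)).1 = Finsupp.single q a.1 := by
  classical
  ext i
  rw [jmap_apply, Finsupp.single_apply, Finsupp.single_apply]
  split_ifs <;> rfl

theorem jmap_inj (Q : Type u) : Function.Injective (jmap f Q) := by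
  intro x y h
  ext1 i
  apply Subtype.ext
  rw [← jmap_apply, ← jmap_apply, h]

theorem jmap_lin {Q : Type u} [AddCommGroup Q] [Module (Corner f) Q]
    (h : Q →ₗ[Corner f] CornerSub f M) (x : Q →₀ Corner f) :
    Finsupp.linearCombination Λ (fun q => (h q).1) (jmap f Q x).1 = (h (frc (Corner f) Q x)).1 := by
  have : (cornerMap f (Finsupp.linearCombination Λ (fun q => (h q).1))).comp (jmap f Q)
      = h.comp (frc (Corner f) Q) := by
    refine Finsupp.lhom_ext fun q a => Subtype.ext ?_
    show Finsupp.linearCombination Λ (fun q => (h q).1) (jmap f Q (Finsupp.single q a)).1 = 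
      (h (frc (Corner f) Q (Finsupp.single q a))).1
    rw [jmap_single, Finsupp.linearCombination_single, Finsupp.linearCombination_single, map_smul]
    rfl
  exact congrArg Subtype.val (LinearMap.congr_fun this x)

theorem lift_proj {Q : Type u} [AddCommGroup Q] [Module (Corner f) Q]
    (hQ : Module.Projective (Corner f) Q) (h : Q →ₗ[Corner f] CornerSub f M) :
    ∃ (P : Type u) (_ : AddCommGroup P) (_ : Module Λ P) (_ : Module.Projective Λ P)
      (g : P →ₗ[Λ] M) (i : Q ≃ₗ[Corner f] CornerSub f P), ∀ q, cornerMap f g (i q) = h q := by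
  obtain ⟨s, hs⟩ := Module.projective_def'.1 hQ
  replace hs : ∀ q, frc (Corner f) Q (s q) = q := fun q => LinearMap.congr_fun hs q
  let js : Q →ₗ[Corner f] CornerSub f (Q →₀ Λ) := (jmap f Q).comp s
  let E : (Q →₀ Λ) →ₗ[Λ] (Q →₀ Λ) := Finsupp.linearCombination Λ (fun q => (js q).1)
  have hE : ∀ x, E (jmap f Q x).1 = (js (frc (Corner f) Q x)).1 := fun x => jmap_lin js x
  have hEs : ∀ q, E (js q).1 = (js q).1 := fun q => by
    show E (jmap f Q (s q)).1 = _
    rw [hE, hs]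
  let g0 : (Q →₀ Λ) →ₗ[Λ] M := Finsupp.linearCombination Λ (fun q => (h q).1)
  have hg0 : ∀ q, g0 (js q).1 = (h q).1 := fun q => by
    show g0 (jmap f Q (s q)).1 = _
    rw [jmap_lin, hs]
  have hEE : E.comp E = E := by
    refine Finsupp.lhom_ext fun q a => ?_
    show E (E (Finsupp.single q a)) = E (Finsupp.single q a)
    have : E (Finsupp.single q a) = a • (js q).1 := Finsupp.linearCombination_single _ _ _
    rw [this, map_smul, hEs]
  have hEE' : ∀ z, E (E z) = E z := fun z => LinearMap.congr_fun hEE z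
  have hfE : ∀ z, ∃ q, f • E z = (js q).1 := by
    intro z
    induction z using Finsupp.induction_linear with
    | zero => exact ⟨0, by simp⟩
    | add x y hx hy =>
      obtain ⟨a, ha⟩ := hx
      obtain ⟨b, hb⟩ := hy
      exact ⟨a + b, by rw [map_add, smul_add, ha, hb, map_add]; rfl⟩
    | single q a =>
      have h1 : E (Finsupp.single q a) = a • (js q).1 := Finsupp.linearCombination_single _ _ _
      let a' : Corner f := ⟨f * a * f, by
        show f * (f * a * f) * f = f * a * f
        simp only [← mul_assoc, hf.out.eq]
        rw [mul_assoc, hf.out.eq]⟩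
      refine ⟨a' • q, ?_⟩
      rw [h1, map_smul]
      show _ = (f * a * f) • (js q).1
      rw [mul_smul, (js q).prop, mul_smul]
  let i0 : Q →ₗ[Corner f] CornerSub f (LinearMap.range E) := (cornerMap f E.rangeRestrict).comp js
  have hi0 : ∀ q, (i0 q).1.1 = (js q).1 := fun q => hEs q
  have hinj : Function.Injective i0 := by
    intro a b hab
    have h1 : js a = js b := Subtype.ext (by rw [← hi0, ← hi0, hab])
    have h2 : s a = s b := jmap_inj Q h1
    rw [← hs a, h2, hs]
  have hsurj : Function.Surjective i0 := by
    intro y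
    obtain ⟨z, hz⟩ := y.1.2
    obtain ⟨q, hq⟩ := hfE z
    refine ⟨q, Subtype.ext (Subtype.ext ?_)⟩
    rw [hi0, ← hq, hz]
    exact congrArg Subtype.val y.prop
  refine ⟨LinearMap.range E, inferInstance, inferInstance, ?_, g0.comp (Submodule.subtype _),
    LinearEquiv.ofBijective i0 ⟨hinj, hsurj⟩, ?_⟩
  · refine Module.Projective.of_split (Submodule.subtype _) E.rangeRestrict ?_
    refine LinearMap.ext fun y => Subtype.ext ?_
    obtain ⟨z, hz⟩ := y.2
    show E y.1 = y.1
    rw [← hz, hEE']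
  · intro q
    apply Subtype.ext
    show g0 (i0 q).1.1 = (h q).1
    rw [hi0, hg0]

theorem backward_step {B : ℕ}
    (hkill : ∀ (M : Type u) [AddCommGroup M] [Module Λ M], (∀ m : M, f • m = 0) → PD Λ M (B + 1))
    (n : ℕ) : ∀ (M : Type u) [AddCommGroup M] [Module Λ M], PD (Corner f) (CornerSub f M) n →
      PD Λ M (B + n + 1) := by
  induction n with
  | zero =>
    intro M _ _ h
    apply hkill
    intro m
    rw [PD.zero_iff] at h
    exact congrArg Subtype.val (Subsingleton.elim (CornerSub.mk' f m) 0)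
  | succ n ih =>
    intro M _ _ h
    obtain ⟨Q, _, _, hQ, q, hq, hqk⟩ : ∃ (Q : Type u) (_ : AddCommGroup Q)
        (_ : Module (Corner f) Q) (_ : Module.Projective (Corner f) Q)
        (q : Q →ₗ[Corner f] CornerSub f M), Function.Surjective q ∧
          PD (Corner f) (LinearMap.ker q) n := by
      cases n with
      | zero =>
        refine ⟨CornerSub f M, inferInstance, inferInstance, PD.one_iff.1 h, LinearMap.id,
          Function.surjective_id, ?_⟩
        rw [PD.zero_iff, LinearMap.ker_id]
        infer_instance
      | succ n =>
        exact ⟨CornerSub f M →₀ Corner f, inferInstance, inferInstance, inferInstance,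
          frc (Corner f) (CornerSub f M), frc_surj, PD.ker_surj _ frc_surj inferInstance h⟩
    obtain ⟨P, _, _, hP, g, i, hgi⟩ := lift_proj hQ q
    have hK : PD (Corner f) (CornerSub f (LinearMap.ker g)) n := by
      let t : CornerSub f (LinearMap.ker g) →ₗ[Corner f] Q :=
        i.symm.toLinearMap.comp (cornerMap f (LinearMap.ker g).subtype)
      have hit : ∀ x, i (t x) = cornerMap f (LinearMap.ker g).subtype x := fun x => by simp [t]
      have ht : ∀ x, t x ∈ LinearMap.ker q := fun x => by
        rw [LinearMap.mem_ker, ← hgi, hit]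
        exact Subtype.ext x.1.2
      refine hqk.equiv (LinearEquiv.ofBijective (t.codRestrict _ ht) ⟨?_, ?_⟩)
      · intro a b hab
        have h1 : t a = t b := congrArg Subtype.val hab
        refine cornerMap_inj (f := f) _ (Submodule.injective_subtype _) ?_
        rw [← hit, ← hit, h1]
      · intro y
        have h1 : g (i y.1).1 = 0 := by
          have := hgi y.1
          rw [LinearMap.mem_ker.1 y.2] at this
          exact congrArg Subtype.val this
        refine ⟨⟨⟨(i y.1).1, h1⟩, Subtype.ext (i y.1).prop⟩, Subtype.ext ?_⟩
        apply i.injective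
        exact (hit _).trans rfl
    have hR : PD Λ (LinearMap.range g) (B + n + 1 + 1) := by
      refine PD.of_ker_surj g.rangeRestrict g.surjective_rangeRestrict
        ((PD.one_iff.2 hP).mono (by omega)) ?_
      rw [LinearMap.ker_rangeRestrict]
      exact ih _ hK
    refine PD.of_quot (LinearMap.range g) hR ((hkill _ ?_).mono (by omega))
    intro m
    obtain ⟨m, rfl⟩ := Submodule.mkQ_surjective _ m
    rw [← map_smul, Submodule.mkQ_apply, Submodule.Quotient.mk_eq_zero]
    obtain ⟨y, hy⟩ := hq (CornerSub.mk' f m)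
    refine ⟨(i y).1, ?_⟩
    have := congrArg Subtype.val (hgi y)
    rw [hy] at this
    exact this

end LiftProj

section Killed

variable {Λ : Type u} [Ring Λ]

theorem ss_split [IsArtinianRing Λ] (N : Type u) [AddCommGroup N] [Module Λ N]
    (M : Type u) [AddCommGroup M] [Module Λ M] {n : ℕ} (hn : PD Λ N n)
    (hS : ∀ a ∈ Ring.jacobson Λ, ∀ x : N, a • x = 0)
    (p : N →ₗ[Λ] M) (hp : Function.Surjective p) : PD Λ M n := by
  have hS' : Module.IsTorsionBySet Λ N (Ring.jacobson Λ) := fun x a => hS a.1 a.2 x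
  have hss : IsSemisimpleModule Λ N := by
    letI := hS'.module
    exact hS'.isSemisimpleModule_iff.1 inferInstance
  obtain ⟨s, hs⟩ := IsSemisimpleModule.lifting_property p hp LinearMap.id
  exact hn.retract s p fun x => LinearMap.congr_fun hs x

theorem pd_killed_ss [IsArtinianRing Λ] (e : Λ) {n : ℕ}
    (h : PD Λ ↥(Submodule.map (jacRad Λ).mkQ (lambdaE e)) n)
    (M : Type u) [AddCommGroup M] [Module Λ M]
    (hM : Module.IsTorsionBySet Λ M (Ring.jacobson Λ)) (he : ∀ m : M, e • m = m) : PD Λ M n := by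
  have hj : jacRad Λ = Ring.jacobson Λ := Ideal.jacobson_bot
  let S := ↥(Submodule.map (jacRad Λ).mkQ (lambdaE e))
  have hS : ∀ a ∈ Ring.jacobson Λ, ∀ x : M →₀ S, a • x = 0 := by
    intro a ha x
    ext1 i
    apply Subtype.ext
    show a • (x i).1 = 0
    obtain ⟨z, hz⟩ := (jacRad Λ).mkQ_surjective (x i).1
    rw [← hz, ← map_smul, Submodule.mkQ_apply, Submodule.Quotient.mk_eq_zero, hj]
    exact Ideal.mul_mem_right z _ ha
  let φ : M → S →ₗ[Λ] M := fun m =>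
    ((jacRad Λ).liftQ (LinearMap.toSpanSingleton Λ M m) (by
      intro a ha
      rw [hj] at ha
      exact @hM m ⟨a, ha⟩)).comp (Submodule.subtype _)
  let p : (M →₀ S) →ₗ[Λ] M := Finsupp.lsum ℕ φ
  let s0 : S := ⟨(jacRad Λ).mkQ e, ⟨e, ⟨1, one_smul _ _⟩, rfl⟩⟩
  have hp : Function.Surjective p := fun m => ⟨Finsupp.single m s0, by
    show Finsupp.lsum ℕ φ (Finsupp.single m s0) = m
    rw [Finsupp.lsum_single]
    exact he m⟩
  exact ss_split (M →₀ S) M (PD.finsupp M n _ h) hS p hp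

theorem pd_killed [IsArtinianRing Λ] (e : Λ) {n : ℕ}
    (h : PD Λ ↥(Submodule.map (jacRad Λ).mkQ (lambdaE e)) n)
    (M : Type u) [AddCommGroup M] [Module Λ M] (he : ∀ m : M, e • m = m) : PD Λ M n := by
  revert he
  refine IsSemiprimaryRing.induction ℤ Λ M
    (P := fun M _ _ _ => (∀ m : M, e • m = m) → PD Λ M n) ?_ ?_
  · intro M _ _ _ _ _ hM he
    exact pd_killed_ss e h M hM he
  · intro M _ _ _ _ N h1 h2 he
    refine PD.of_quot N (h1 fun m => Subtype.ext (he m.1)) (h2 fun m => ?_)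
    obtain ⟨m, rfl⟩ := Submodule.mkQ_surjective _ m
    rw [← map_smul, he]

end Killed

theorem finite_global_dimension_comparison
    {Λ : Type u} [Ring Λ]
    (C : Type u) [CommRing C] [IsArtinianRing C] [Algebra C Λ] [Module.Finite C Λ]
    (e : Λ) [he : Fact (IsIdempotentElem e)]
    [HasExt.{u} (ModuleCat.{u} Λ)] [HasExt.{u} (ModuleCat.{u} (Corner (1 - e)))]
    (hsub : ∀ x : Λ, (1 - e) * x * e ∈ jacRad Λ)
    (hpdstar : ∃ c : ℕ, ∀ (N : ModuleCat.{u} (Corner (1 - e))) (k : ℕ), c < k →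
      Subsingleton (Abelian.Ext
        (ModuleCat.of (Corner (1 - e)) (CornerSub (1 - e) ↥(lambdaE e))) N k))
    (hpd : ∃ a : ℕ, ∀ (N : ModuleCat.{u} Λ) (k : ℕ), a < k →
      Subsingleton (Abelian.Ext (radQuotPart Λ e) N k))
    (hid : ∃ b : ℕ, ∀ (N : ModuleCat.{u} Λ) (k : ℕ), b < k →
      Subsingleton (Abelian.Ext N (radQuotPart Λ e) k)) :
    (∃ n : ℕ, ∀ (M N : ModuleCat.{u} Λ) (k : ℕ), n < k →
        Subsingleton (Abelian.Ext M N k)) ↔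
      (∃ n : ℕ, ∀ (M N : ModuleCat.{u} (Corner (1 - e))) (k : ℕ), n < k →
        Subsingleton (Abelian.Ext M N k)) := by
  constructor
  · rintro ⟨n, hn⟩
    obtain ⟨c, hc⟩ := hpdstar
    have hc' := pd_fLambda e (PD.iff_ext.2 hc)
    refine ⟨n + c, fun M N k hk => ?_⟩
    have h1 : PD (Corner (1 - e)) M (n + c + 1) :=
      forward hc' (fun M _ _ => PD.iff_ext.2 fun N k hk => hn (ModuleCat.of Λ M) N k hk) M
    exact PD.iff_ext.1 h1 N k hk
  · rintro ⟨n, hn⟩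
    obtain ⟨a, ha⟩ := hpd
    have : IsArtinianRing Λ := IsArtinianRing.of_finite C Λ
    have ha' : PD Λ ↥(Submodule.map (jacRad Λ).mkQ (lambdaE e)) (a + 1) := PD.iff_ext.2 ha
    refine ⟨a + (n + 1), fun M N k hk => ?_⟩
    have h1 : PD Λ M (a + (n + 1) + 1) :=
      backward_step (f := 1 - e) (fun M _ _ hM => pd_killed e ha' M fun m => by
        have := hM m
        rw [sub_smul, one_smul, sub_eq_zero] at this
        exact this.symm) (n + 1) M
        (PD.iff_ext.2 fun N k hk => hn (ModuleCat.of _ (CornerSub (1 - e) M)) N k hk)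
    exact PD.iff_ext.1 h1 N k hk
end

section
/- Let K be a field, Q a finite quiver, I an admissible ideal of KQ (so J^n ⊆ I ⊆ J^2 for some n ≥ 2, J the arrow ideal), and Λ = KQ/I. Let e be the idempotent of Λ given by a vertex v with no loop, f = 1 − e, and Λ* = fΛf. If pd_Λ((Λ/r)e) ≤ 1, then fΛe is a projective left Λ*-module (so pd_{Λ*}(fΛe) ≤ 1 and Hom_{Λ*}(fΛ, −) is exact). -/
/-! STATEMENT 17: Let `Λ = KQ/I` be a finite dimensional algebra given by a quiver with
an admissible ideal, and `e` the primitive idempotent at a vertex `v` with no loop,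
`f = 1 - e`, `Λ* = fΛf`.  If `pd_Λ((Λ/r)e) ≤ 1` then `fΛe` is a projective left
`Λ*`-module (hence `pd_{Λ*}(fΛe) ≤ 1` and `Hom_{Λ*}(fΛ, -)` is exact).
The quiver presentation is abstracted: `Λ` is a finite dimensional `K`-algebra, `e` a
primitive idempotent with `fΛe ⊆ r` (automatic for vertex idempotents of `KQ/I`), and
"no loop at `v`" is encoded as `Ext¹_Λ(Sᵥ, Sᵥ) = 0` for the simple `Sᵥ = (Λ/r)e`. -/

universe u

open CategoryTheory

theorem aux_corner_projective {Λ : Type u} [Ring Λ] (f : Λ) [hf : Fact (IsIdempotentElem f)]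
    (P : Type u) [AddCommGroup P] [Module Λ P] [Module.Projective Λ P]
    (hP : Submodule.span Λ {p : P | f • p = p} = ⊤) :
    Module.Projective (Corner f) (CornerSub f P) := by
  let g : (CornerSub f P →₀ Λ) →ₗ[Λ] P :=
    Finsupp.linearCombination Λ (fun x : CornerSub f P => x.1)
  have hg : LinearMap.range g = ⊤ := by
    rw [Finsupp.range_linearCombination, ← hP]
    congr 1
    ext p
    exact ⟨fun ⟨x, hx⟩ => hx ▸ x.2, fun h => ⟨⟨p, h⟩, rfl⟩⟩
  obtain ⟨s, hs⟩ := g.exists_rightInverse_of_surjective hg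
  let c : Λ →+ Corner f :=
    { toFun := fun a => ⟨f * a * f, by
        show f * (f * a * f) * f = f * a * f
        rw [← mul_assoc, ← mul_assoc, hf.out, mul_assoc (f * a), hf.out]⟩
      map_zero' := Subtype.ext (by show f * 0 * f = 0; simp)
      map_add' := fun a b => Subtype.ext (by
        show f * (a + b) * f = f * a * f + f * b * f
        rw [mul_add, add_mul]) }
  let i : CornerSub f P →ₗ[Corner f] (CornerSub f P →₀ Corner f) :=
    { toFun := fun p => Finsupp.mapRange c c.map_zero (s p.1)
      map_add' := fun p q => by
        have : s (p + q).1 = s p.1 + s q.1 := s.map_add p.1 q.1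
        rw [this, Finsupp.mapRange_add (map_add c)]
      map_smul' := fun a p => by
        have : s (a • p).1 = a.1 • s p.1 := s.map_smul a.1 p.1
        rw [this]
        ext x
        refine Subtype.ext ?_
        have h2 : s p.1 = f • s p.1 := by
          rw [← map_smul]; congr 1; exact p.2.symm
        show f * (a.1 * s p.1 x) * f = a.1 * (f * s p.1 x * f)
        have h3 : f * s p.1 x = s p.1 x := by
          conv_rhs => rw [h2]
          rfl
        rw [h3, ← mul_assoc f, Corner.absorb_left a.2, mul_assoc] }
  refine Module.Projective.of_split i
    (Finsupp.linearCombination (Corner f) (fun x : CornerSub f P => x)) ?_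
  ext p
  refine Subtype.ext ?_
  let val : CornerSub f P →+ P := (cornerSubAddSubgroup f P).subtype
  show val (Finsupp.linearCombination (Corner f) (fun x : CornerSub f P => x)
    (Finsupp.mapRange c c.map_zero (s p.1))) = p.1
  have key : ∀ t : CornerSub f P →₀ Λ,
      val (Finsupp.linearCombination (Corner f) (fun x : CornerSub f P => x)
        (Finsupp.mapRange c c.map_zero t)) = f • g t := by
    intro t
    induction t using Finsupp.induction_linear with
    | zero => simp
    | add t u ht hu => rw [Finsupp.mapRange_add (map_add c), map_add, map_add, ht, hu, map_add, smul_add]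
    | single x a =>
      simp only [Finsupp.mapRange_single, Finsupp.linearCombination_single, g]
      show (f * a * f) • x.1 = f • a • x.1
      rw [mul_smul, mul_smul]
      congr 2
      exact x.2
  rw [key]
  have : g (s p.1) = p.1 := LinearMap.congr_fun hs p.1
  rw [this]
  exact p.2

theorem aux_span_top {Λ : Type u} [Ring Λ] [IsArtinianRing Λ] (e : Λ)
    (he : IsIdempotentElem e)
    (P : Type u) [AddCommGroup P] [Module Λ P] [Module.Finite Λ P]
    (hP : ∀ φ : P →ₗ[Λ] ↥(Submodule.map (jacRad Λ).mkQ (lambdaE e)), φ = 0) :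
    Submodule.span Λ {p : P | (1 - e) • p = p} = ⊤ := by
  by_contra hne
  obtain ⟨N, hN, hle⟩ := (eq_top_or_exists_le_coatom
    (Submodule.span Λ {p : P | (1 - e) • p = p})).resolve_left hne
  have hsimp : IsSimpleModule Λ (P ⧸ N) := isSimpleModule_iff_isCoatom.mpr hN
  have hjac : jacRad Λ = Ring.jacobson Λ := Ideal.jacobson_bot
  have hfix : ∀ t : P ⧸ N, e • t = t := by
    intro t
    obtain ⟨p, rfl⟩ := N.mkQ_surjective t
    have : (1 - e) • p ∈ N := hle (Submodule.subset_span (by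
      show (1 - e) • (1 - e) • p = (1 - e) • p
      rw [smul_smul, he.one_sub]))
    rw [← map_smul, ← sub_eq_zero, ← map_sub, ← neg_eq_zero, ← map_neg]
    rw [Submodule.mkQ_apply, Submodule.Quotient.mk_eq_zero]
    convert this using 1
    rw [sub_smul, one_smul, neg_sub]
  have hss : IsSemisimpleModule Λ (Λ ⧸ jacRad Λ) := by
    rw [IsArtinian.isSemisimpleModule_iff_jacobson, hjac]
    exact Module.jacobson_quotient_jacobson Λ Λ
  have hnt : Nontrivial (P ⧸ N) := IsSimpleModule.nontrivial Λ _
  obtain ⟨t, ht⟩ := exists_ne (0 : P ⧸ N)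
  let m : (Λ ⧸ jacRad Λ) →ₗ[Λ] (P ⧸ N) :=
    (jacRad Λ).liftQ (LinearMap.toSpanSingleton Λ _ t) (by
      rw [hjac]
      intro x hx
      rw [LinearMap.mem_ker, LinearMap.toSpanSingleton_apply]
      exact Module.mem_annihilator.mp (IsSemisimpleModule.jacobson_le_annihilator Λ (P ⧸ N) hx) t)
  let ψ := m.domRestrict (Submodule.map (jacRad Λ).mkQ (lambdaE e))
  have hψ0 : ψ ≠ 0 := by
    intro h
    have := LinearMap.congr_fun h ⟨(jacRad Λ).mkQ e, Submodule.mem_map_of_mem ⟨1, by simp⟩⟩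
    apply ht
    rw [← hfix t]
    simpa [ψ, m] using this
  have hψ : Function.Surjective ψ := LinearMap.surjective_of_ne_zero hψ0
  obtain ⟨j, hj⟩ := IsSemisimpleModule.lifting_property ψ hψ LinearMap.id
  have h0 := hP (j ∘ₗ N.mkQ)
  apply ht
  obtain ⟨p, rfl⟩ := N.mkQ_surjective t
  have h1 : j (N.mkQ p) = 0 := LinearMap.congr_fun h0 p
  have h2 := LinearMap.congr_fun hj (N.mkQ p)
  simp only [LinearMap.comp_apply, h1, map_zero, LinearMap.id_apply] at h2
  exact h2.symm


theorem corner_projective_of_pd_le_one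
    {K : Type u} [Field K] {Λ : Type u} [Ring Λ] [Algebra K Λ] [FiniteDimensional K Λ]
    (e : Λ) [he : Fact (IsIdempotentElem e)]
    [HasExt.{u} (ModuleCat.{u} Λ)]
    -- `e` is primitive (it is the idempotent of a single vertex `v`)
    (hprim : ∀ a b : Λ, IsIdempotentElem a → IsIdempotentElem b →
      a * b = 0 → b * a = 0 → a + b = e → a = 0 ∨ b = 0)
    -- there is no loop at `v`
    (hnoloop : Subsingleton (Abelian.Ext (radQuotPart Λ e) (radQuotPart Λ e) 1))
    -- `fΛe ⊆ r` (automatic for a quotient of a path algebra by an admissible ideal)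
    (hsub : ∀ x : Λ, (1 - e) * x * e ∈ jacRad Λ)
    -- `pd_Λ((Λ/r)e) ≤ 1`
    (hpd : ∀ (N : ModuleCat.{u} Λ) (k : ℕ), 1 < k →
      Subsingleton (Abelian.Ext (radQuotPart Λ e) N k)) :
    Module.Projective (Corner (1 - e)) (CornerSub (1 - e) ↥(lambdaE e)) := by
  have : IsArtinianRing Λ := IsArtinianRing.of_finite K Λ
  let S := Submodule.map (jacRad Λ).mkQ (lambdaE e)
  let π : ↥(lambdaE e) →ₗ[Λ] S := (jacRad Λ).mkQ.submoduleMap (lambdaE e)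
  have hπ : Function.Surjective π := LinearMap.submoduleMap_surjective _ _
  have hEe : ∀ x : ↥(lambdaE e), x.1 * e = x.1 := by
    rintro ⟨x, y, rfl⟩
    simp [mul_assoc, he.out.eq]
  let R := LinearMap.ker π
  have hR : ∀ x : ↥(lambdaE e), x ∈ R ↔ x.1 ∈ jacRad Λ := by
    intro x
    rw [LinearMap.mem_ker, ← Subtype.coe_inj]
    exact Submodule.Quotient.mk_eq_zero _
  have hprojE : Module.Projective Λ ↥(lambdaE e) := by
    refine Module.Projective.of_split (lambdaE e).subtype
      (LinearMap.toSpanSingleton Λ Λ e).rangeRestrict ?_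
    ext x
    exact hEe x
  let C : ShortComplex (ModuleCat.{u} Λ) :=
    ShortComplex.mk (X₁ := ModuleCat.of Λ R) (X₂ := ModuleCat.of Λ ↥(lambdaE e))
      (X₃ := radQuotPart Λ e) (ModuleCat.ofHom R.subtype) (ModuleCat.ofHom π) (by
        ext x
        exact x.2)
  have hC : C.ShortExact := ModuleCat.shortComplex_shortExact C
    (LinearMap.exact_subtype_ker_map π) R.injective_subtype hπ
  have hpC : Projective C.X₂ := (IsProjective.iff_projective _).mp hprojE
  have hpd2 : HasProjectiveDimensionLT C.X₃ 2 :=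
    HasProjectiveDimensionLT.mk (fun i hi Y x => (hpd Y i hi).elim _ _)
  have hpd1 := (hC.hasProjectiveDimensionLT_X₃_iff 0 hpC).mp hpd2
  have hprojR : Module.Projective Λ R :=
    (IsProjective.iff_projective _).mpr (projective_iff_hasProjectiveDimensionLT_one.mpr hpd1)
  have hhom : ∀ φ : R →ₗ[Λ] S, φ = 0 := by
    intro φ
    let φ' : C.X₁ ⟶ radQuotPart Λ e := ModuleCat.ofHom φ
    obtain ⟨x₂, hx₂⟩ := Abelian.Ext.contravariant_sequence_exact₁ hC _
      (Abelian.Ext.mk₀ φ') (add_zero 1) (hnoloop.elim _ _)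
    obtain ⟨χ, rfl⟩ := Abelian.Ext.homEquiv₀.symm.surjective x₂
    rw [Abelian.Ext.homEquiv₀_symm_apply, Abelian.Ext.mk₀_comp_mk₀] at hx₂
    have h3 : C.f ≫ χ = φ' := Abelian.Ext.homEquiv₀.symm.injective hx₂
    let χ' : ↥(lambdaE e) →ₗ[Λ] S := χ.hom
    ext x : 1
    have h4 : φ x = χ' x.1 := by
      have := congrArg (fun k => k.hom x) h3
      exact this.symm
    rw [h4]
    have h5 : x.1 = x.1.1 • (⟨e, 1, by simp⟩ : ↥(lambdaE e)) := Subtype.ext (hEe x.1).symm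
    rw [h5, map_smul]
    have hx : x.1.1 ∈ Ring.jacobson Λ := by
      have := (hR x.1).mp x.2
      rwa [jacRad, Ideal.jacobson_bot] at this
    obtain ⟨q, hq⟩ := (jacRad Λ).mkQ_surjective (χ' ⟨e, 1, by simp⟩).1
    refine Subtype.ext ?_
    rw [Submodule.coe_smul, ← hq, ← map_smul]
    refine (Submodule.Quotient.mk_eq_zero _).mpr ?_
    rw [jacRad, Ideal.jacobson_bot, smul_eq_mul]
    exact Ideal.mul_mem_right _ _ hx
  have hspan := aux_span_top e he.out R hhom
  have hfin := aux_corner_projective (1 - e) R hspan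
  refine Module.Projective.of_equiv
    (LinearEquiv.ofBijective (cornerMap (1 - e) R.subtype) ⟨?_, ?_⟩)
  · intro x y hxy
    have h : (cornerMap (1 - e) R.subtype x).1 = (cornerMap (1 - e) R.subtype y).1 := by
      rw [hxy]
    exact Subtype.ext (Subtype.ext h)
  · intro y
    have hy : (1 - e) * y.1.1 = y.1.1 := congrArg Subtype.val y.2
    have hyR : y.1 ∈ R := by
      rw [hR, ← hEe, ← hy]
      exact hsub _
    exact ⟨⟨⟨y.1, hyR⟩, Subtype.ext y.2⟩, rfl⟩
end
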